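/- arXiv:2506.02276 — 5 statements merged into one kernel-verified Lean document; each statement's English description precedes it below -/
import Mathlib

section
/- Let h, σ : ℝ → ℝ be continuous functions. For real s ≤ t define a(s,t) = exp(∫_s^t h(τ) dτ) and b(s,t) = ∫_s^t σ(v)^2 · a(v,t)^2 dv. Then for every real t, the function t ↦ b(0,t) has derivative at t equal to σ(t)^2 + 2·h(t)·b(0,t). -/
/-- `a s t = exp (∫_s^t h τ dτ)`, the transition factor of the linear SDE. -/
noncomputable def aCoef (h : ℝ → ℝ) (s t : ℝ) : ℝ := Real.exp (∫ τ in s..t, h τ)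

/-- `b s t = ∫_s^t σ(v)^2 a(v,t)^2 dv`, the accumulated variance. -/
noncomputable def bCoef (h σ : ℝ → ℝ) (s t : ℝ) : ℝ :=
  ∫ v in s..t, σ v ^ 2 * aCoef h v t ^ 2

/-- `d/dt b(0,t) = σ(t)^2 + 2 h(t) b(0,t)`. -/
theorem hasDerivAt_b_left (h σ : ℝ → ℝ) (hh : Continuous h) (hσ : Continuous σ)
    (t : ℝ) :
    HasDerivAt (fun t => bCoef h σ 0 t) (σ t ^ 2 + 2 * h t * bCoef h σ 0 t) t := by
  have hH : ∀ x, HasDerivAt (fun u => ∫ τ in (0:ℝ)..u, h τ) (h x) x := fun x =>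
    intervalIntegral.integral_hasDerivAt_right (hh.intervalIntegrable _ _)
      (hh.stronglyMeasurableAtFilter _ _) hh.continuousAt
  generalize hHdef : (fun u => ∫ τ in (0:ℝ)..u, h τ) = H at hH
  have hHc : Continuous H := continuous_iff_continuousAt.2 fun x => (hH x).continuousAt
  have ha : ∀ v u, aCoef h v u ^ 2 = Real.exp (2 * H u) * Real.exp (-(2 * H v)) := by
    intro v u
    have e : ∫ τ in v..u, h τ = H u - H v := by
      rw [← hHdef]
      exact (intervalIntegral.integral_interval_sub_left
        (hh.intervalIntegrable _ _) (hh.intervalIntegrable _ _)).symm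
    rw [aCoef, e, ← Real.exp_add, ← Real.exp_nat_mul]
    congr 1
    push_cast
    ring
  have hb : ∀ u, bCoef h σ 0 u =
      Real.exp (2 * H u) * ∫ v in (0:ℝ)..u, σ v ^ 2 * Real.exp (-(2 * H v)) := by
    intro u
    rw [bCoef, ← intervalIntegral.integral_const_mul]
    congr 1
    funext v
    rw [ha]
    ring
  have hg : Continuous fun v => σ v ^ 2 * Real.exp (-(2 * H v)) := by fun_prop
  have hG : HasDerivAt (fun u => ∫ v in (0:ℝ)..u, σ v ^ 2 * Real.exp (-(2 * H v)))
      (σ t ^ 2 * Real.exp (-(2 * H t))) t :=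
    intervalIntegral.integral_hasDerivAt_right (hg.intervalIntegrable _ _)
      (hg.stronglyMeasurableAtFilter _ _) hg.continuousAt
  have key := (((hH t).const_mul 2).exp).mul hG
  simp only [hb]
  refine key.congr_deriv ?_
  have e1 : Real.exp (2 * H t) * Real.exp (-(2 * H t)) = 1 := by
    rw [← Real.exp_add, add_neg_cancel, Real.exp_zero]
  linear_combination σ t ^ 2 * e1
end

section
/- Let h, σ : ℝ → ℝ be continuous functions with σ(t) > 0 for all t. For real s ≤ t define a(s,t) = exp(∫_s^t h(τ) dτ) and b(s,t) = ∫_s^t σ(v)^2 · a(v,t)^2 dv, and for t ∈ [0,1] define κ(t) = b(0,t)·a(t,1)/b(0,1). Then for every t ∈ (0,1), κ has derivative at t equal to σ(t)^2 · a(t,1)/b(0,1) + κ(t)·h(t). -/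
/-- `κ t = b(0,t) a(t,1) / b(0,1)`, the `z₁`-coefficient of the interpolant. -/
noncomputable def kappaC (h σ : ℝ → ℝ) (t : ℝ) : ℝ :=
  bCoef h σ 0 t * aCoef h t 1 / bCoef h σ 0 1

/-- `ν t = b(t,1) a(0,t) / b(0,1)`, the `z₀`-coefficient of the interpolant. -/
noncomputable def nuC (h σ : ℝ → ℝ) (t : ℝ) : ℝ :=
  bCoef h σ t 1 * aCoef h 0 t / bCoef h σ 0 1

/-- `η t = √(b(0,t) b(t,1) / b(0,1))`, the noise coefficient of the interpolant. -/
noncomputable def etaC (h σ : ℝ → ℝ) (t : ℝ) : ℝ :=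
  Real.sqrt (bCoef h σ 0 t * bCoef h σ t 1 / bCoef h σ 0 1)

/-- `κ'(t) = σ(t)^2 a(t,1)/b(0,1) + κ(t) h(t)` on `(0,1)`. -/
theorem hasDerivAt_kappa (h σ : ℝ → ℝ) (hh : Continuous h) (hσ : Continuous σ)
    (hσpos : ∀ t, 0 < σ t) (t : ℝ) (ht : t ∈ Set.Ioo (0 : ℝ) 1) :
    HasDerivAt (kappaC h σ)
      (σ t ^ 2 * aCoef h t 1 / bCoef h σ 0 1 + kappaC h σ t * h t) t := by
  set H : ℝ → ℝ := fun s => ∫ τ in (0:ℝ)..s, h τ with hH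
  have hHd : ∀ s, HasDerivAt H (h s) s := fun s =>
    intervalIntegral.integral_hasDerivAt_right (hh.intervalIntegrable _ _)
      hh.stronglyMeasurable.stronglyMeasurableAtFilter hh.continuousAt
  have hHc : Continuous H := continuous_iff_continuousAt.2 fun s => (hHd s).continuousAt
  have ha : ∀ s t, aCoef h s t = Real.exp (H t - H s) := by
    intro s t
    rw [aCoef, hH]
    simp only
    rw [intervalIntegral.integral_interval_sub_left (hh.intervalIntegrable _ _)
      (hh.intervalIntegrable _ _)]
  set g : ℝ → ℝ := fun v => σ v ^ 2 * Real.exp (-H v) ^ 2 with hg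
  have hgc : Continuous g := by fun_prop
  set G : ℝ → ℝ := fun s => ∫ v in (0:ℝ)..s, g v with hG
  have hGd : HasDerivAt G (g t) t :=
    intervalIntegral.integral_hasDerivAt_right (hgc.intervalIntegrable _ _)
      hgc.stronglyMeasurable.stronglyMeasurableAtFilter hgc.continuousAt
  have hb : ∀ s, bCoef h σ 0 s = Real.exp (H s) ^ 2 * G s := by
    intro s
    rw [bCoef, hG]
    simp only
    rw [← intervalIntegral.integral_const_mul]
    congr 1
    funext v
    rw [ha, hg, sub_eq_add_neg, Real.exp_add]
    ring
  have hk : kappaC h σ = fun s => Real.exp (H s) * G s * (Real.exp (H 1) / bCoef h σ 0 1) := by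
    funext s
    rw [kappaC, hb s, ha, Real.exp_sub]
    have := (Real.exp_pos (H s)).ne'
    field_simp
  rw [hk]
  refine (((hHd t).exp.mul hGd).mul_const (Real.exp (H 1) / bCoef h σ 0 1)).congr_deriv ?_
  rw [ha, Real.exp_sub, hg]
  simp only
  rw [Real.exp_neg]
  have := (Real.exp_pos (H t)).ne'
  field_simp
  ring
end

section
/- Let h, σ : ℝ → ℝ be continuous functions with σ(t) > 0 for all t. For real s ≤ t define a(s,t) = exp(∫_s^t h(τ) dτ) and b(s,t) = ∫_s^t σ(v)^2 · a(v,t)^2 dv, and for t ∈ [0,1] define ν(t) = b(t,1)·a(0,t)/b(0,1). Then for every t ∈ (0,1), ν has derivative at t equal to ν(t)·(h(t) − σ(t)^2 · a(t,1)^2 / b(t,1)). -/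
/-- `ν'(t) = ν(t) (h(t) − σ(t)^2 a(t,1)^2 / b(t,1))` on `(0,1)`. -/
theorem hasDerivAt_nu (h σ : ℝ → ℝ) (hh : Continuous h) (hσ : Continuous σ)
    (hσpos : ∀ t, 0 < σ t) (t : ℝ) (ht : t ∈ Set.Ioo (0 : ℝ) 1) :
    HasDerivAt (nuC h σ)
      (nuC h σ t * (h t - σ t ^ 2 * aCoef h t 1 ^ 2 / bCoef h σ t 1)) t := by
  have hac : Continuous (fun v => aCoef h v 1) := by
    unfold aCoef
    refine Real.continuous_exp.comp ?_
    have : (fun v => ∫ τ in v..1, h τ) = fun v => -∫ τ in (1:ℝ)..v, h τ := by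
      funext v
      exact intervalIntegral.integral_symm _ _
    rw [this]
    exact (intervalIntegral.continuous_primitive
      (fun a b => hh.intervalIntegrable a b) 1).neg
  have hf : Continuous (fun v => σ v ^ 2 * aCoef h v 1 ^ 2) := (hσ.pow 2).mul (hac.pow 2)
  have hb : HasDerivAt (fun s => bCoef h σ s 1) (-(σ t ^ 2 * aCoef h t 1 ^ 2)) t :=
    intervalIntegral.integral_hasDerivAt_left (hf.intervalIntegrable _ _)
      (hf.stronglyMeasurableAtFilter _ _) hf.continuousAt
  have ha : HasDerivAt (fun s => aCoef h 0 s) (aCoef h 0 t * h t) t :=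
    (intervalIntegral.integral_hasDerivAt_right (hh.intervalIntegrable _ _)
      (hh.stronglyMeasurableAtFilter _ _) hh.continuousAt).exp
  have hpos : 0 < bCoef h σ t 1 := by
    refine intervalIntegral.intervalIntegral_pos_of_pos (hf.intervalIntegrable _ _) ?_ ht.2
    intro v
    have h1 := hσpos v
    have h2 : 0 < aCoef h v 1 := Real.exp_pos _
    positivity
  have hd := (hb.mul ha).div_const (bCoef h σ 0 1)
  refine hd.congr_deriv ?_
  unfold nuC
  have hne := hpos.ne'
  have key : bCoef h σ t 1 * (h t - σ t ^ 2 * aCoef h t 1 ^ 2 / bCoef h σ t 1)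
      = bCoef h σ t 1 * h t - σ t ^ 2 * aCoef h t 1 ^ 2 := by
    field_simp
  linear_combination (-(aCoef h 0 t / bCoef h σ 0 1)) * key
end

section
/- Let h, σ : ℝ → ℝ be continuous functions with σ(t) > 0 for all t. For real s ≤ t define a(s,t) = exp(∫_s^t h(τ) dτ) and b(s,t) = ∫_s^t σ(v)^2 · a(v,t)^2 dv, and for t ∈ [0,1] define ν(t) = b(t,1)·a(0,t)/b(0,1) and η(t) = √(b(0,t)·b(t,1)/b(0,1)). Then for every t ∈ (0,1), η has derivative at t equal to σ(t)^2/(2·η(t)) + (η(t)/ν(t))·ν'(t), where ν'(t) = ν(t)·(h(t) − σ(t)^2 · a(t,1)^2 / b(t,1)) is the derivative of ν at t. -/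
open intervalIntegral in
theorem aCoef_eq_div (h : ℝ → ℝ) (hh : Continuous h) (s t : ℝ) :
    aCoef h s t = aCoef h 0 t / aCoef h 0 s := by
  unfold aCoef
  rw [← Real.exp_sub, integral_interval_sub_left (hh.intervalIntegrable _ _)
    (hh.intervalIntegrable _ _)]

theorem aCoef_pos (h : ℝ → ℝ) (s t : ℝ) : 0 < aCoef h s t := Real.exp_pos _

theorem hasDerivAt_aCoef (h : ℝ → ℝ) (hh : Continuous h) (t : ℝ) :
    HasDerivAt (aCoef h 0) (aCoef h 0 t * h t) t :=
  (hh.integral_hasStrictDerivAt 0 t).hasDerivAt.exp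

/-- Normalised accumulated variance. -/
noncomputable def gAux (h σ : ℝ → ℝ) (t : ℝ) : ℝ := ∫ v in (0 : ℝ)..t, σ v ^ 2 / aCoef h 0 v ^ 2

theorem continuous_gAux_integrand (h σ : ℝ → ℝ) (hh : Continuous h) (hσ : Continuous σ) :
    Continuous (fun v => σ v ^ 2 / aCoef h 0 v ^ 2) := by
  have hc : Continuous (aCoef h 0) :=
    continuous_iff_continuousAt.2 fun t => (hasDerivAt_aCoef h hh t).continuousAt
  exact (hσ.pow 2).div (hc.pow 2) fun v => (pow_pos (aCoef_pos h 0 v) 2).ne'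

theorem bCoef_eq (h σ : ℝ → ℝ) (hh : Continuous h) (hσ : Continuous σ) (s t : ℝ) :
    bCoef h σ s t = aCoef h 0 t ^ 2 * (gAux h σ t - gAux h σ s) := by
  have hc := continuous_gAux_integrand h σ hh hσ
  unfold bCoef gAux
  rw [intervalIntegral.integral_interval_sub_left (hc.intervalIntegrable _ _)
    (hc.intervalIntegrable _ _), ← intervalIntegral.integral_const_mul]
  congr 1
  funext v
  rw [aCoef_eq_div h hh v t]
  ring

theorem gAux_lt (h σ : ℝ → ℝ) (hh : Continuous h) (hσ : Continuous σ)
    (hσpos : ∀ t, 0 < σ t) {s t : ℝ} (hst : s < t) : gAux h σ s < gAux h σ t := by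
  have hc := continuous_gAux_integrand h σ hh hσ
  rw [← sub_pos]
  unfold gAux
  rw [intervalIntegral.integral_interval_sub_left (hc.intervalIntegrable _ _)
    (hc.intervalIntegrable _ _)]
  refine intervalIntegral.intervalIntegral_pos_of_pos (hc.intervalIntegrable _ _) (fun v => ?_) hst
  have := hσpos v
  have := aCoef_pos h 0 v
  positivity

/-- `η'(t) = σ(t)^2/(2η(t)) + (η(t)/ν(t)) ν'(t)` on `(0,1)`, where
`ν'(t) = ν(t)(h(t) − σ(t)^2 a(t,1)^2/b(t,1))` is the derivative of `ν`. -/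
theorem hasDerivAt_eta (h σ : ℝ → ℝ) (hh : Continuous h) (hσ : Continuous σ)
    (hσpos : ∀ t, 0 < σ t) (t : ℝ) (ht : t ∈ Set.Ioo (0 : ℝ) 1) :
    HasDerivAt (etaC h σ)
      (σ t ^ 2 / (2 * etaC h σ t) +
        (etaC h σ t / nuC h σ t) *
          (nuC h σ t * (h t - σ t ^ 2 * aCoef h t 1 ^ 2 / bCoef h σ t 1))) t := by
  obtain ⟨h0, h1⟩ := ht
  have g00 : gAux h σ 0 = 0 := by simp [gAux]
  have hg0 := gAux_lt h σ hh hσ hσpos h0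
  have hg1 := gAux_lt h σ hh hσ hσpos h1
  rw [g00] at hg0
  have hA := aCoef_pos h 0 t
  have hA1 := aCoef_pos h 0 1
  have hdA := hasDerivAt_aCoef h hh t
  have hdG : HasDerivAt (gAux h σ) (σ t ^ 2 / aCoef h 0 t ^ 2) t :=
    ((continuous_gAux_integrand h σ hh hσ).integral_hasStrictDerivAt 0 t).hasDerivAt
  have hG1 : 0 < gAux h σ 1 := hg0.trans hg1
  have heta : etaC h σ = fun x => Real.sqrt
      (aCoef h 0 x ^ 2 * (gAux h σ x * (gAux h σ 1 - gAux h σ x)) / gAux h σ 1) := by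
    funext x
    unfold etaC
    congr 1
    simp only [bCoef_eq h σ hh hσ, g00, sub_zero]
    field_simp
  have hν : nuC h σ t ≠ 0 := by
    unfold nuC
    simp only [bCoef_eq h σ hh hσ, g00, sub_zero]
    have := sub_pos.2 hg1
    positivity
  have hd := sub_pos.2 hg1
  have hpos : 0 < aCoef h 0 t ^ 2 * (gAux h σ t * (gAux h σ 1 - gAux h σ t)) / gAux h σ 1 := by
    positivity
  have hη : 0 < etaC h σ t := by rw [heta]; exact Real.sqrt_pos.2 hpos
  have hsq : etaC h σ t ^ 2 =
      aCoef h 0 t ^ 2 * (gAux h σ t * (gAux h σ 1 - gAux h σ t)) / gAux h σ 1 := by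
    rw [heta]; exact Real.sq_sqrt hpos.le
  have key := (((hdA.fun_pow 2).fun_mul (hdG.fun_mul (hdG.const_sub (gAux h σ 1)))).div_const
    (gAux h σ 1)).sqrt hpos.ne'
  have hs : Real.sqrt (aCoef h 0 t ^ 2 * (gAux h σ t * (gAux h σ 1 - gAux h σ t)) / gAux h σ 1)
      = etaC h σ t := by rw [heta]
  rw [hs, ← heta] at key
  convert key using 1
  rw [aCoef_eq_div h hh t 1, bCoef_eq h σ hh hσ, ← mul_assoc, div_mul_cancel₀ _ hν,
    eq_div_iff (by positivity)]
  generalize etaC h σ t = e at *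
  generalize aCoef h 0 t = A at *
  generalize aCoef h 0 1 = B at *
  generalize gAux h σ t = G at *
  generalize gAux h σ 1 = K at *
  have hd' : K - G ≠ 0 := hd.ne'
  have e1 : (σ t ^ 2 / (2 * e) + e * (h t - σ t ^ 2 * (B / A) ^ 2 / (B ^ 2 * (K - G)))) * (2 * e)
      = σ t ^ 2 + 2 * e ^ 2 * (h t - σ t ^ 2 / (A ^ 2 * (K - G))) := by
    field_simp
  rw [e1, hsq]
  push_cast
  field_simp
  ring
end

section
/- Let h, σ : ℝ → ℝ be continuous functions with σ(t) > 0 for all t. For real s ≤ t define a(s,t) = exp(∫_s^t h(τ) dτ) and b(s,t) = ∫_s^t σ(v)^2 · a(v,t)^2 dv, and for t ∈ [0,1] define κ(t) = b(0,t)·a(t,1)/b(0,1) and ν(t) = b(t,1)·a(0,t)/b(0,1). Then for every t ∈ (0,1), the Wronskian-type identity σ(t)^2 = (b(0,1)/a(0,1)) · (ν(t)·κ'(t) − κ(t)·ν'(t)) holds, where κ'(t) = σ(t)^2·a(t,1)/b(0,1) + κ(t)·h(t) and ν'(t) = ν(t)·(h(t) − σ(t)^2·a(t,1)^2/b(t,1))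 are the derivatives of κ and ν at t. -/
theorem aux_a (h : ℝ → ℝ) (hh : Continuous h) (s t : ℝ) :
    aCoef h s t = Real.exp (∫ τ in (0:ℝ)..t, h τ) / Real.exp (∫ τ in (0:ℝ)..s, h τ) := by
  rw [aCoef, ← Real.exp_sub, intervalIntegral.integral_interval_sub_left
    (hh.intervalIntegrable _ _) (hh.intervalIntegrable _ _)]

theorem aux_E (h : ℝ → ℝ) (hh : Continuous h) (t : ℝ) :
    HasDerivAt (fun t => Real.exp (∫ τ in (0:ℝ)..t, h τ))
      (Real.exp (∫ τ in (0:ℝ)..t, h τ) * h t) t :=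
  (hh.integral_hasStrictDerivAt 0 t).hasDerivAt.exp

theorem aux_cont (h σ : ℝ → ℝ) (hh : Continuous h) (hσ : Continuous σ) :
    Continuous (fun v => σ v ^ 2 / Real.exp (∫ τ in (0:ℝ)..v, h τ) ^ 2) := by
  have hE : Continuous (fun t => Real.exp (∫ τ in (0:ℝ)..t, h τ)) :=
    continuous_iff_continuousAt.2 fun t => (aux_E h hh t).continuousAt
  exact (hσ.pow 2).div (hE.pow 2) fun v => by positivity

theorem aux_b (h σ : ℝ → ℝ) (hh : Continuous h) (hσ : Continuous σ) (s t : ℝ) :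
    bCoef h σ s t = Real.exp (∫ τ in (0:ℝ)..t, h τ) ^ 2 *
      ((∫ v in (0:ℝ)..t, σ v ^ 2 / Real.exp (∫ τ in (0:ℝ)..v, h τ) ^ 2) -
       ∫ v in (0:ℝ)..s, σ v ^ 2 / Real.exp (∫ τ in (0:ℝ)..v, h τ) ^ 2) := by
  have hc := aux_cont h σ hh hσ
  rw [intervalIntegral.integral_interval_sub_left
    (hc.intervalIntegrable _ _) (hc.intervalIntegrable _ _), bCoef,
    ← intervalIntegral.integral_const_mul]
  congr 1
  funext v
  rw [aux_a h hh]
  ring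

/-- Wronskian identity: `σ(t)^2 = (b(0,1)/a(0,1)) (ν(t) κ'(t) − κ(t) ν'(t))`
on `(0,1)`, where `κ'`, `ν'` are the derivatives of `κ`, `ν`. -/
theorem sigma_sq_from_kappa_nu (h σ : ℝ → ℝ) (hh : Continuous h) (hσ : Continuous σ)
    (hσpos : ∀ t, 0 < σ t) (t : ℝ) (ht : t ∈ Set.Ioo (0 : ℝ) 1) :
    σ t ^ 2 =
      (bCoef h σ 0 1 / aCoef h 0 1) *
        (nuC h σ t * deriv (kappaC h σ) t - kappaC h σ t * deriv (nuC h σ) t) := by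
  have hc := aux_cont h σ hh hσ
  have hG1 : 0 < ∫ v in (0:ℝ)..1, σ v ^ 2 / Real.exp (∫ τ in (0:ℝ)..v, h τ) ^ 2 :=
    intervalIntegral.intervalIntegral_pos_of_pos (hc.intervalIntegrable _ _)
      (fun v => by have := hσpos v; positivity) one_pos
  have hEd := aux_E h hh
  have hGd := fun t => (hc.integral_hasStrictDerivAt 0 t).hasDerivAt
  have hEp : ∀ t, 0 < Real.exp (∫ τ in (0:ℝ)..t, h τ) := fun t => Real.exp_pos _
  have hE0 : Real.exp (∫ τ in (0:ℝ)..0, h τ) = 1 := by simp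
  have hG0 : (∫ v in (0:ℝ)..0, σ v ^ 2 / Real.exp (∫ τ in (0:ℝ)..v, h τ) ^ 2) = 0 := by simp
  have ha := aux_a h hh
  have hb := aux_b h σ hh hσ
  set E : ℝ → ℝ := fun t => Real.exp (∫ τ in (0:ℝ)..t, h τ) with hE
  set G : ℝ → ℝ := fun t => ∫ v in (0:ℝ)..t, σ v ^ 2 / Real.exp (∫ τ in (0:ℝ)..v, h τ) ^ 2 with hG
  change ∀ s t, aCoef h s t = E t / E s at ha
  change ∀ s t, bCoef h σ s t = E t ^ 2 * (G t - G s) at hb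
  change ∀ t, HasDerivAt E (E t * h t) t at hEd
  change ∀ t, HasDerivAt G (σ t ^ 2 / E t ^ 2) t at hGd
  change ∀ t, 0 < E t at hEp
  change 0 < G 1 at hG1
  change E 0 = 1 at hE0
  change G 0 = 0 at hG0
  clear_value E G
  have hE1 := (hEp 1).ne'
  have hG1' := hG1.ne'
  have hk : kappaC h σ = fun t => E t * G t / (E 1 * G 1) := by
    funext t
    have := (hEp t).ne'
    simp only [kappaC, ha, hb, hG0, sub_zero]
    field_simp
  have hn : nuC h σ = fun t => (G 1 - G t) * E t / G 1 := by
    funext t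
    simp only [nuC, ha, hb, hG0, hE0, sub_zero]
    field_simp
  have hkd := (((hEd t).mul (hGd t)).div_const (E 1 * G 1)).deriv
  have hnd := ((((hGd t).const_sub (G 1)).mul (hEd t)).div_const (G 1)).deriv
  have hkd' : deriv (kappaC h σ) t = _ := hk ▸ hkd
  have hnd' : deriv (nuC h σ) t = _ := hn ▸ hnd
  rw [hkd', hnd', hk, hn, ha, hb, hG0, hE0]
  have := (hEp t).ne'
  field_simp
  ring
end
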